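/- Let 𝔥 be a semisimple Lie algebra over ℂ with Killing form B, viewed inside 𝔰𝔬(𝔥) via the adjoint representation. Suppose P ∈ 𝒫(𝔥) (so P : 𝔥 → ad 𝔥 with the cyclic identity) and P is skew in the sense that the bilinear form (x,y) ↦ B(P(x), y) is antisymmetric (identifying ad 𝔥 ≅ 𝔥). Then P is a derivation of 𝔥, i.e. P([x,y]) = [P(x), y] + [x, P(y)] for all x, y ∈ 𝔥. -/

import Mathlib

/-- If `𝔥` is a finite-dimensional complex semisimple Lie algebra with
Killing form `B`, `P ∈ 𝒫(𝔥)` (cyclic identity w.r.t. the adjoint representation) and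
the form `(x,y) ↦ B(P x, y)` is antisymmetric, then `P` is a derivation. -/
theorem derivation_of_antisymmetric_P
    {L : Type*} [LieRing L] [LieAlgebra ℂ L] [FiniteDimensional ℂ L]
    [LieAlgebra.IsSemisimple ℂ L]
    (P : L →ₗ[ℂ] L)
    (hcyc : ∀ x y z : L,
      killingForm ℂ L ⁅P x, y⁆ z + killingForm ℂ L ⁅P y, z⁆ x
        + killingForm ℂ L ⁅P z, x⁆ y = 0)
    (hanti : ∀ x y : L, killingForm ℂ L (P x) y = -killingForm ℂ L (P y) x) :
    ∀ x y : L, P ⁅x, y⁆ = ⁅P x, y⁆ + ⁅x, P y⁆ := by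
  intro x y
  have hK : LieAlgebra.IsKilling ℂ L := inferInstance
  have hker := LieAlgebra.IsKilling.ker_killingForm_eq_bot ℂ L
  rw [← sub_eq_zero, ← Submodule.mem_bot ℂ, ← hker, LinearMap.mem_ker]
  ext z
  have h1 := hcyc x y z
  have h2 : killingForm ℂ L ⁅P y, z⁆ x = killingForm ℂ L ⁅x, P y⁆ z := by
    rw [LieModule.traceForm_comm, LieModule.traceForm_apply_lie_apply]
  have h3 : killingForm ℂ L ⁅P z, x⁆ y = killingForm ℂ L (P z) ⁅x, y⁆ :=
    LieModule.traceForm_apply_lie_apply ℂ L L _ _ _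
  have h4 := hanti ⁅x, y⁆ z
  simp only [map_sub, map_add, LinearMap.sub_apply, LinearMap.add_apply, LinearMap.zero_apply]
  rw [h2, h3] at h1
  linear_combination h4 - h1
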